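/- Let X be a finite additive subgroup of a non-archimedean field contained in the filled Julia set of a Drinfeld module φ over L_v, and let T ∈ A be non-constant with deg φ_T = q^R. Then there exists an additive subgroup Y ⊆ X with #Y ≥ q^{−4R²} · #X such that for every nonzero x ∈ Y, both x and φ_T(x) are T-generic, where x is T-generic means |φ_T(x)| = max_{0 ≤ i ≤ R} |a_i x^{q^i}| for φ_T(x) = Σ a_i x^{q^i} (a_0 = T). -/

import Mathlib

/-- `x` is `T`-generic for the additive polynomial
`f = φ_T = Σ_{i≤R} a_i x^{q^i}`: the norm of `f.eval x` equals the maximum of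
the norms of the individual terms (by the ultrametric inequality `≤` always
holds, so this says every term is bounded by `‖f.eval x‖`). -/
def TGeneric {Cv : Type*} [NontriviallyNormedField Cv] (q R : ℕ)
    (f : Polynomial Cv) (x : Cv) : Prop :=
  ∀ i ≤ R, ‖f.coeff (q ^ i) * x ^ q ^ i‖ ≤ ‖f.eval x‖

/-- The ultrametric inequality for a difference. -/
theorem norm_sub_le_max_norm {G : Type*} [SeminormedAddCommGroup G] [IsUltrametricDist G]
    (x y : G) : ‖x - y‖ ≤ max ‖x‖ ‖y‖ := by
  simpa [sub_eq_add_neg] using IsUltrametricDist.norm_add_le_max x (-y)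

open scoped Pointwise in
/-- The sum of two finite subgroups of a commutative group is finite. -/
theorem AddSubgroup.finite_sup {G : Type*} [AddCommGroup G] (A B : AddSubgroup G) [Finite A]
    [Finite B] : Finite (A ⊔ B : AddSubgroup G) := by
  change Finite ((A ⊔ B : AddSubgroup G) : Set G)
  rw [AddSubgroup.add_normal]
  exact (Set.Finite.add (Set.toFinite (A : Set G)) (Set.toFinite (B : Set G))).to_subtype

open Polynomial in
/-- Evaluation of an additive polynomial over an infinite field stays additive over any
extension field. -/
theorem Polynomial.eval_map_add_of_eval_add {K L : Type*} [Field K] [Infinite K] [Field L]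
    (i : K →+* L) (f : K[X]) (hadd : ∀ x y : K, f.eval (x + y) = f.eval x + f.eval y)
    (x y : L) : (f.map i).eval (x + y) = (f.map i).eval x + (f.map i).eval y := by
  have hinf : (Set.range i).Infinite := Set.infinite_range_of_injective i.injective
  have extend (z : L) (h : ∀ a : K,
      (f.map i).eval (i a + z) = (f.map i).eval (i a) + (f.map i).eval z) (w : L) :
      (f.map i).eval (w + z) = (f.map i).eval w + (f.map i).eval z := by
    have key : (f.map i).comp (X + C z) = f.map i + C ((f.map i).eval z) := by
      refine Polynomial.eq_of_infinite_eval_eq _ _ (hinf.mono ?_)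
      rintro _ ⟨a, rfl⟩
      simpa using h a
    simpa using congrArg (Polynomial.eval w) key
  refine extend y (fun a => ?_) x
  rw [add_comm, add_comm ((f.map i).eval _)]
  refine extend (i a) (fun b => ?_) y
  rw [← map_add i, Polynomial.eval_map_apply, hadd, map_add, Polynomial.eval_map_apply,
    Polynomial.eval_map_apply]

/-- Every nonarchimedean normed field embeds isometrically into an algebraically closed one. -/
theorem exists_isAlgClosed_norm_extension.{u} (K : Type u) [NontriviallyNormedField K]
    [IsUltrametricDist K] :
    ∃ (L : Type u) (_ : NormedField L) (_ : IsUltrametricDist L) (_ : IsAlgClosed L)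
      (i : K →+* L), ∀ x, ‖i x‖ = ‖x‖ := by
  let Khat := UniformSpace.Completion K
  let : NontriviallyNormedField Khat :=
    { (inferInstance : NormedField (UniformSpace.Completion K)) with
      non_trivial := by
        obtain ⟨x, hx⟩ := NontriviallyNormedField.non_trivial (α := K)
        exact ⟨(x : UniformSpace.Completion K), by
          simpa only [UniformSpace.Completion.norm_coe] using hx⟩ }
  have : CompleteSpace Khat := inferInstanceAs (CompleteSpace (UniformSpace.Completion K))
  have : IsUltrametricDist Khat := by
    refine IsUltrametricDist.isUltrametricDist_of_forall_norm_add_le_max_norm fun x y => ?_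
    refine UniformSpace.Completion.induction_on₂
      (p := fun x y : UniformSpace.Completion K => ‖x + y‖ ≤ max ‖x‖ ‖y‖) x y ?_ fun a b => ?_
    · exact isClosed_le (by fun_prop) (by fun_prop)
    · simpa only [← UniformSpace.Completion.coe_add, UniformSpace.Completion.norm_coe] using
        IsUltrametricDist.norm_add_le_max a b
  let : NormedField (AlgebraicClosure Khat) :=
    spectralNorm.normedField Khat (AlgebraicClosure Khat)
  refine ⟨AlgebraicClosure Khat, inferInstance, ?_, inferInstance,
    (algebraMap Khat (AlgebraicClosure Khat)).comp UniformSpace.Completion.coeRingHom,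
    fun x => ?_⟩
  · exact IsUltrametricDist.isUltrametricDist_of_isNonarchimedean_norm
      (isNonarchimedean_spectralNorm (K := Khat) (L := AlgebraicClosure Khat))
  · exact (spectralNorm_extends (K := Khat) (L := AlgebraicClosure Khat) _).trans
      (UniformSpace.Completion.norm_coe x)

/-- In an ultrametric field of characteristic `p`, a subgroup of a finite subgroup admits a
norm-orthogonal complement. -/
theorem AddSubgroup.exists_norm_orthogonal_complement {L : Type*} [NormedField L]
    [IsUltrametricDist L] (p : ℕ) [Fact p.Prime] [CharP L p] (V W : AddSubgroup L) [Finite W]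
    (hVW : V ≤ W) :
    ∃ C : AddSubgroup L, W ≤ C ⊔ V ∧ ∀ c ∈ C, ∀ v ∈ V, ‖v‖ ≤ ‖c + v‖ := by
  have hfin : {C : AddSubgroup L | C ≤ W ∧ ∀ c ∈ C, ∀ v ∈ V, ‖v‖ ≤ ‖c + v‖}.Finite := by
    refine Set.Finite.of_finite_image (f := fun C : AddSubgroup L => (C : Set L)) ?_
      SetLike.coe_injective.injOn
    refine (Set.toFinite (W : Set L)).finite_subsets.subset ?_
    rintro _ ⟨C, hC, rfl⟩
    exact hC.1
  obtain ⟨C, hC⟩ := hfin.exists_maximal ⟨⊥, bot_le, by simp⟩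
  obtain ⟨⟨hCW, horth⟩, hmax⟩ := hC
  refine ⟨C, fun w₀ hw₀ => ?_, horth⟩
  by_contra hnot
  -- a representative of minimal norm modulo `C ⊔ V`
  obtain ⟨w, ⟨hwW, hwU⟩, hmin⟩ := Set.exists_min_image {w : L | w ∈ W ∧ w - w₀ ∈ C ⊔ V}
    (fun w => ‖w‖) ((Set.toFinite (W : Set L)).subset fun _ h => h.1)
    ⟨w₀, hw₀, by simp⟩
  have hUW : C ⊔ V ≤ W := sup_le hCW hVW
  have hmin' : ∀ u ∈ C ⊔ V, ‖w‖ ≤ ‖w + u‖ := fun u hu =>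
    hmin _ ⟨add_mem hwW (hUW hu), by
      rw [add_sub_right_comm]
      exact add_mem hwU hu⟩
  have hwC : w ∉ C := fun h => hnot (by
    simpa using sub_mem (AddSubgroup.mem_sup_left (T := V) h) hwU)
  have hsmul : ∀ (m : ℤ) (x : L), ‖m • x‖ ≤ ‖x‖ := fun m x => by
    rw [zsmul_eq_mul, norm_mul]
    exact mul_le_of_le_one_left (norm_nonneg _) (IsUltrametricDist.norm_intCast_le_one L m)
  have hle : C ⊔ AddSubgroup.zmultiples w ≤ C := by
    refine hmax ⟨sup_le hCW ((AddSubgroup.zmultiples_le).2 hwW), fun d hd v hv => ?_⟩ le_sup_left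
    obtain ⟨c, hc, _, ⟨k, rfl⟩, rfl⟩ := AddSubgroup.mem_sup.1 hd
    by_cases hk : (k : L) = 0
    · simpa [zsmul_eq_mul, hk] using horth c hc v hv
    have hpk : IsCoprime k (p : ℤ) := by
      rw [isCoprime_comm, (Nat.prime_iff_prime_int.1 Fact.out : Prime (p : ℤ)).coprime_iff_not_dvd]
      rwa [← CharP.intCast_eq_zero_iff L p]
    obtain ⟨m, n, hmn⟩ := hpk
    have hmk : (m : L) * k = 1 := by
      have := congrArg (Int.cast : ℤ → L) hmn
      simpa using this
    have hu : c + v ∈ C ⊔ V := AddSubgroup.add_mem_sup hc hv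
    have h1 : ‖w‖ ≤ ‖c + k • w + v‖ := by
      refine (hmin' (m • (c + v)) (zsmul_mem hu m)).trans ?_
      refine le_trans (le_of_eq ?_) (hsmul m _)
      congr 1
      simp only [zsmul_eq_mul]
      linear_combination (-w) * hmk
    have h2 : ‖c + v‖ ≤ ‖c + k • w + v‖ := by
      have : c + v = (c + k • w + v) - k • w := by abel
      rw [this]
      exact (norm_sub_le_max_norm _ _).trans (max_le le_rfl ((hsmul k w).trans h1))
    exact (horth c hc v hv).trans h2
  exact hwC (hle (AddSubgroup.mem_sup_right (AddSubgroup.mem_zmultiples w)))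

/-- The index in `A` of a complement of `V` is at most the cardinality of `V`. -/
theorem AddSubgroup.relIndex_le_card_of_le_sup {G : Type*} [AddCommGroup G]
    (A C V : AddSubgroup G) [Finite V] (h : A ≤ C ⊔ V) : C.relIndex A ≤ Nat.card V := by
  have hdvd := AddSubgroup.relIndex_dvd_card C V
  have hne : C.relIndex V ≠ 0 := fun h0 => by
    rw [h0, zero_dvd_iff] at hdvd
    exact Nat.card_pos.ne' hdvd
  rw [← AddSubgroup.relIndex_sup_left] at hdvd hne
  exact (AddSubgroup.relIndex_le_of_le_right h hne).trans (Nat.le_of_dvd Nat.card_pos hdvd)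

open Polynomial in
/-- If `x` is at distance at least `max ‖x‖ ‖ξ‖` from each root `ξ` of a split polynomial, then
every monomial of the polynomial is bounded at `x` by the value at `x`. -/
theorem Polynomial.norm_coeff_mul_pow_le_norm_eval {L : Type*} [NormedField L]
    [IsUltrametricDist L] (g : L[X]) (hg : g.Splits) (x : L)
    (hx : ∀ ξ ∈ g.roots, ‖x‖ ≤ ‖x - ξ‖ ∧ ‖ξ‖ ≤ ‖x - ξ‖) (n : ℕ) :
    ‖g.coeff n * x ^ n‖ ≤ ‖g.eval x‖ := by
  have key : ∀ s : Multiset L, (∀ ξ ∈ s, ‖x‖ ≤ ‖x - ξ‖ ∧ ‖ξ‖ ≤ ‖x - ξ‖) → ∀ n : ℕ,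
      ‖((s.map fun a => X - C a).prod).coeff n * x ^ n‖ ≤
        ‖((s.map fun a => X - C a).prod).eval x‖ := by
    intro s
    induction s using Multiset.induction_on with
    | empty =>
      intro _ n
      rcases n with _ | n <;> simp [coeff_one]
    | cons a s ih =>
      intro hs n
      have ih := ih fun ξ hξ => hs ξ (Multiset.mem_cons_of_mem hξ)
      obtain ⟨h1, h2⟩ := hs a (Multiset.mem_cons_self a s)
      simp only [Multiset.map_cons, Multiset.prod_cons, eval_mul, eval_sub, eval_X, eval_C,
        norm_mul]
      set P := (s.map fun a => X - C a).prod
      rw [← norm_mul, sub_mul, coeff_sub, coeff_C_mul, sub_mul]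
      refine (norm_sub_le_max_norm _ _).trans (max_le ?_ ?_)
      · rcases n with _ | n
        · simp only [coeff_X_mul_zero, zero_mul, norm_zero]
          positivity
        · rw [coeff_X_mul, pow_succ', mul_left_comm, norm_mul]
          exact mul_le_mul h1 (ih n) (norm_nonneg _) (norm_nonneg _)
      · rw [mul_assoc, norm_mul]
        exact mul_le_mul h2 (ih n) (norm_nonneg _) (norm_nonneg _)
  rw [hg.eq_prod_roots]
  simp only [coeff_C_mul, eval_mul, eval_C, mul_assoc]
  rw [norm_mul, norm_mul g.leadingCoeff]
  exact mul_le_mul_of_nonneg_left (key _ hx n) (norm_nonneg _)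

/-- A field carrying an additive polynomial of degree at least two has positive
characteristic. -/
theorem Polynomial.not_charZero_of_eval_add {K : Type*} [Field K] (f : Polynomial K)
    (hdeg : 2 ≤ f.natDegree)
    (hadd : ∀ x y : K, f.eval (x + y) = f.eval x + f.eval y) : ¬ CharZero K := by
  intro _
  have key : f.comp (Polynomial.C 2 * Polynomial.X) = Polynomial.C 2 * f :=
    Polynomial.funext fun x => by simp [two_mul, hadd]
  have h := congrArg (fun g => Polynomial.coeff g f.natDegree) key
  simp only [Polynomial.comp_C_mul_X_coeff, Polynomial.coeff_C_mul] at h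
  rw [mul_comm] at h
  have hlead : f.coeff f.natDegree ≠ 0 := by
    rw [Polynomial.coeff_natDegree, Polynomial.leadingCoeff_ne_zero]
    rintro rfl
    simp at hdeg
  have h2 : ((2 ^ f.natDegree : ℕ) : K) = (2 : ℕ) := by
    exact_mod_cast mul_right_cancel₀ hlead h
  have h3 : 2 ^ f.natDegree = 2 ^ 1 := by simpa using Nat.cast_injective h2
  have := Nat.pow_right_injective le_rfl h3
  omega

/-- if `X` is a finite additive subgroup of the filled Julia set
of `φ_T` (with `deg φ_T = q^R`, `R = r·deg T`), then there is an additive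
subgroup `Y ⊆ X` with `#Y ≥ q^(−4R²)·#X` such that every nonzero `x ∈ Y` has
both `x` and `φ_T(x)` `T`-generic. -/
theorem generic_subgroup_selection
    {Cv : Type*} [NontriviallyNormedField Cv] [IsUltrametricDist Cv]
    (q r dT R : ℕ) (hq : 2 ≤ q) (hr : 1 ≤ r) (hdT : 1 ≤ dT) (hR : R = r * dT)
    (f : Polynomial Cv) (hdeg : f.natDegree = q ^ R)
    (hsupp : ∀ n : ℕ, f.coeff n ≠ 0 → ∃ i ≤ R, n = q ^ i)
    (hadd : ∀ x y : Cv, f.eval (x + y) = f.eval x + f.eval y)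
    (X : AddSubgroup Cv) [Finite X]
    (hX : (X : Set Cv) ⊆ {x | ∃ B : ℝ, ∀ n : ℕ, ‖(f.eval)^[n] x‖ ≤ B}) :
    ∃ Y : AddSubgroup Cv, Y ≤ X ∧
      (Nat.card X : ℝ) ≤ (q : ℝ) ^ (4 * R ^ 2) * (Nat.card Y : ℝ) ∧
      ∀ x ∈ Y, x ≠ 0 → TGeneric q R f x ∧ TGeneric q R f (f.eval x) := by
  have hR1 : 1 ≤ R := hR ▸ Nat.mul_pos hr hdT
  have hdeg2 : 2 ≤ f.natDegree := by
    rw [hdeg]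
    exact hq.trans (Nat.le_self_pow (by omega) q)
  obtain ⟨p, _⟩ := CharP.exists Cv
  rcases CharP.char_is_prime_or_zero Cv p with hp | rfl
  swap
  · exact absurd (CharP.charP_to_charZero Cv) (f.not_charZero_of_eval_add hdeg2 hadd)
  have : Fact p.Prime := ⟨hp⟩
  obtain ⟨L, _, _, _, i, hi⟩ := exists_isAlgClosed_norm_extension Cv
  have : CharP L p := charP_of_injective_ringHom i.injective p
  have hf0 : f ≠ 0 := by
    rintro rfl
    simp at hdeg2
  have hg0 : f.map i ≠ 0 := (Polynomial.map_ne_zero_iff i.injective).2 hf0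
  let F : Cv →+ Cv := AddMonoidHom.mk' f.eval hadd
  let G : L →+ L := AddMonoidHom.mk' (f.map i).eval (f.eval_map_add_of_eval_add i hadd)
  let j : Cv →+ L := i.toAddMonoidHom
  let V : AddSubgroup L := G.ker
  have hV : ∀ ξ, ξ ∈ V ↔ ξ ∈ (f.map i).roots := fun ξ => by
    rw [Polynomial.mem_roots hg0]
    exact AddMonoidHom.mem_ker
  classical
  have hVset : (V : Set L) = ((f.map i).roots.toFinset : Set L) := by
    ext ξ
    simpa using hV ξ
  have : Finite V := by
    change Finite (V : Set L)
    rw [hVset]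
    infer_instance
  have hVcard : Nat.card V ≤ q ^ R := by
    change Nat.card (V : Set L) ≤ q ^ R
    rw [hVset, Nat.card_coe_set_eq, Set.ncard_coe_finset, ← hdeg,
      ← Polynomial.natDegree_map (p := f) i]
    exact (Multiset.toFinset_card_le _).trans (Polynomial.card_roots' _)
  let X₁ : AddSubgroup L := X.map j
  let X₂ : AddSubgroup L := X.map (j.comp F)
  have : Finite X₁ := inferInstanceAs (Finite (j '' (X : Set Cv)))
  have : Finite X₂ := inferInstanceAs (Finite ((j.comp F) '' (X : Set Cv)))
  let W : AddSubgroup L := X₁ ⊔ X₂ ⊔ V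
  have : Finite (X₁ ⊔ X₂ : AddSubgroup L) := AddSubgroup.finite_sup _ _
  have : Finite W := AddSubgroup.finite_sup _ _
  obtain ⟨C, hWC, hC⟩ := AddSubgroup.exists_norm_orthogonal_complement p V W le_sup_right
  have hgen : ∀ x : Cv, i x ∈ C → TGeneric q R f x := by
    intro x hx k _
    have h := (f.map i).norm_coeff_mul_pow_le_norm_eval (IsAlgClosed.splits _) (i x)
      (fun ξ hξ => ?_) (q ^ k)
    · rwa [Polynomial.coeff_map, ← map_pow, ← map_mul, hi, Polynomial.eval_map_apply, hi] at h
    · have h1 : ‖ξ‖ ≤ ‖i x - ξ‖ := by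
        simpa [sub_eq_add_neg] using hC _ hx (-ξ) (neg_mem ((hV ξ).2 hξ))
      refine ⟨?_, h1⟩
      calc ‖i x‖ = ‖(i x - ξ) + ξ‖ := by rw [sub_add_cancel]
        _ ≤ max ‖i x - ξ‖ ‖ξ‖ := IsUltrametricDist.norm_add_le_max _ _
        _ ≤ ‖i x - ξ‖ := max_le le_rfl h1
  let Z : AddSubgroup Cv := C.comap j ⊓ C.comap (j.comp F)
  have hindex : Z.relIndex X ≤ q ^ R * q ^ R := by
    refine AddSubgroup.relIndex_inf_le.trans (Nat.mul_le_mul ?_ ?_)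
    · rw [AddSubgroup.relIndex_comap]
      exact (AddSubgroup.relIndex_le_card_of_le_sup _ C V
        ((le_sup_left.trans le_sup_left).trans hWC)).trans hVcard
    · rw [AddSubgroup.relIndex_comap]
      exact (AddSubgroup.relIndex_le_card_of_le_sup _ C V
        ((le_sup_right.trans le_sup_left).trans hWC)).trans hVcard
  refine ⟨Z ⊓ X, inf_le_right, ?_, fun x hx _ => ⟨hgen x hx.1.1, hgen _ hx.1.2⟩⟩
  have hcard : Nat.card X = Z.relIndex X * Nat.card (Z ⊓ X : AddSubgroup Cv) := by
    have h := AddSubgroup.relIndex_mul_relIndex ⊥ (Z ⊓ X) X bot_le inf_le_right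
    rw [AddSubgroup.relIndex_bot_left, AddSubgroup.relIndex_bot_left,
      AddSubgroup.inf_relIndex_right] at h
    rw [← h, mul_comm]
  have hpow : q ^ R * q ^ R ≤ q ^ (4 * R ^ 2) := by
    rw [← pow_add]
    exact Nat.pow_le_pow_right (by omega) (by nlinarith)
  rw [hcard]
  exact_mod_cast Nat.mul_le_mul_right _ (hindex.trans hpow)
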